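/- Let Z and Z' be real b×f matrices with Z' = Z + σG where ‖G‖_op = 1 and Z has full column rank. Then the optimal predictor P* = (Z^T Z)^{-1} Z^T Z' satisfies ‖P* P*^T − P*‖_op / ‖P*‖_op ≤ σ ‖Z⁺‖_op, where Z⁺ = (Z^T Z)^{-1} Z^T is the pseudoinverse; in particular the relative deviation from orthogonal projection tends to 0 as σ → 0. -/

import Mathlib

open Matrix Filter

noncomputable def frobSq {m n : ℕ} (A : Matrix (Fin m) (Fin n) ℝ) : ℝ := ∑ i, ∑ j, (A i j)^2

noncomputable def frobNorm {m n : ℕ} (A : Matrix (Fin m) (Fin n) ℝ) : ℝ := Real.sqrt (frobSq A)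

noncomputable def opNorm {m n : ℕ} (A : Matrix (Fin m) (Fin n) ℝ) : ℝ :=
  ‖(Matrix.toEuclideanLin.trans LinearMap.toContinuousLinearMap) A‖

open scoped Matrix.Norms.L2Operator in
theorem opNorm_eq_l2 {m n : ℕ} (A : Matrix (Fin m) (Fin n) ℝ) : opNorm A = ‖A‖ := by
  rw [Matrix.l2_opNorm_def]; rfl

open scoped Matrix.Norms.L2Operator in
theorem predictor_aux {b f : ℕ}
    (Z G : Matrix (Fin b) (Fin f) ℝ) (hZ : IsUnit (Zᵀ * Z)) (hG : opNorm G = 1)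
    (s : ℝ) (hs : 0 ≤ s) :
      opNorm (((Zᵀ * Z)⁻¹ * Zᵀ * (Z + s • G)) * ((Zᵀ * Z)⁻¹ * Zᵀ * (Z + s • G))ᵀ -
          (Zᵀ * Z)⁻¹ * Zᵀ * (Z + s • G)) /
        opNorm ((Zᵀ * Z)⁻¹ * Zᵀ * (Z + s • G)) ≤ s * opNorm ((Zᵀ * Z)⁻¹ * Zᵀ) := by
  have hP : (Zᵀ * Z)⁻¹ * Zᵀ * (Z + s • G) = 1 + s • ((Zᵀ * Z)⁻¹ * Zᵀ * G) := by
    rw [Matrix.mul_add, Matrix.mul_smul, Matrix.mul_assoc _ Zᵀ Z,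
      Matrix.nonsing_inv_mul _ ((Matrix.isUnit_iff_isUnit_det _).1 hZ)]
  rw [hP]
  generalize (Zᵀ * Z)⁻¹ * Zᵀ = Y
  simp only [opNorm_eq_l2] at *
  have hT : ‖(s • (Y * G))ᵀ‖ ≤ s * ‖Y‖ := by
    rw [← Matrix.conjTranspose_eq_transpose_of_trivial, Matrix.l2_opNorm_conjTranspose,
      norm_smul, Real.norm_of_nonneg hs]
    have := Matrix.l2_opNorm_mul Y G
    rw [hG, mul_one] at this
    gcongr
  set P := 1 + s • (Y * G) with hPd
  have e : P * Pᵀ - P = P * (s • (Y * G))ᵀ := by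
    have : Pᵀ = 1 + (s • (Y * G))ᵀ := by rw [hPd, Matrix.transpose_add, Matrix.transpose_one]
    rw [this, Matrix.mul_add, Matrix.mul_one, add_sub_cancel_left]
  rw [e]
  apply div_le_of_le_mul₀ (norm_nonneg _) (by positivity)
  calc _ ≤ ‖P‖ * ‖(s • (Y * G))ᵀ‖ := Matrix.l2_opNorm_mul _ _
    _ ≤ ‖P‖ * (s * ‖Y‖) := by gcongr
    _ = _ := mul_comm _ _

/-- relative deviation of the optimal predictor from an orthogonal
projection is controlled by σ ‖Z⁺‖ and tends to 0 as σ → 0. -/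
theorem predictor_quasi_orthogonality {b f : ℕ}
    (Z G : Matrix (Fin b) (Fin f) ℝ) (hZ : IsUnit (Zᵀ * Z)) (hG : opNorm G = 1)
    (σ : ℕ → ℝ) (hσ : ∀ t, 0 ≤ σ t) :
    (∀ t,
      opNorm (((Zᵀ * Z)⁻¹ * Zᵀ * (Z + σ t • G)) * ((Zᵀ * Z)⁻¹ * Zᵀ * (Z + σ t • G))ᵀ -
          (Zᵀ * Z)⁻¹ * Zᵀ * (Z + σ t • G)) /
        opNorm ((Zᵀ * Z)⁻¹ * Zᵀ * (Z + σ t • G)) ≤ σ t * opNorm ((Zᵀ * Z)⁻¹ * Zᵀ)) ∧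
    (Tendsto σ atTop (nhds 0) →
      Tendsto (fun t =>
        opNorm (((Zᵀ * Z)⁻¹ * Zᵀ * (Z + σ t • G)) * ((Zᵀ * Z)⁻¹ * Zᵀ * (Z + σ t • G))ᵀ -
            (Zᵀ * Z)⁻¹ * Zᵀ * (Z + σ t • G)) /
          opNorm ((Zᵀ * Z)⁻¹ * Zᵀ * (Z + σ t • G))) atTop (nhds 0)) := by
  refine ⟨fun t => predictor_aux Z G hZ hG (σ t) (hσ t), fun h => ?_⟩
  refine squeeze_zero (fun t => div_nonneg (norm_nonneg _) (norm_nonneg _))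
    (fun t => predictor_aux Z G hZ hG (σ t) (hσ t)) ?_
  simpa using h.mul_const (opNorm ((Zᵀ * Z)⁻¹ * Zᵀ))
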